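/- Fix k ≥ 2 and suppose Γ: {ω·k, ω*·k} ≤_c {D₀, D₁}, where D₀ is a linear order without infinite descending chains and D₁ is an infinite linear order without infinite ascending chains. Then D₀ contains a suborder of type ω·k and D₁ contains a suborder of type ω*·k. -/

import Mathlib

/-- A finite linear order: a finite piece of an atomic diagram in the language `{<}`,
with domain a finite set of naturals. -/
structure FinLO where
  dom : Finset ℕ
  rel : ℕ → ℕ → Prop
  irrefl : ∀ x ∈ dom, ¬ rel x x
  trans : ∀ x ∈ dom, ∀ y ∈ dom, ∀ z ∈ dom, rel x y → rel y z → rel x z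
  total : ∀ x ∈ dom, ∀ y ∈ dom, x ≠ y → rel x y ∨ rel y x

/-- `β` extends `α` as a finite atomic diagram. -/
def FinLO.Ext (α β : FinLO) : Prop :=
  α.dom ⊆ β.dom ∧ ∀ x ∈ α.dom, ∀ y ∈ α.dom, (α.rel x y ↔ β.rel x y)

/-- An enumeration operator on finite linear orders: it monotonically enumerates
membership facts `x ∈ Γ(α)`, positive atomic facts `x < y` and negative atomic
facts `¬ x < y`. -/
structure EnumOp where
  mem : FinLO → Set ℕ
  pos : FinLO → Set (ℕ × ℕ)
  neg : FinLO → Set (ℕ × ℕ)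
  mono_mem : ∀ {α β : FinLO}, α.Ext β → mem α ⊆ mem β
  mono_pos : ∀ {α β : FinLO}, α.Ext β → pos α ⊆ pos β
  mono_neg : ∀ {α β : FinLO}, α.Ext β → neg α ⊆ neg β

/-- The outputs of `Γ` are consistent with being part of the atomic diagram of
a linear order. -/
def EnumOp.Consistent (Γ : EnumOp) : Prop :=
  ∀ α : FinLO, (∀ x : ℕ, (x, x) ∉ Γ.pos α) ∧
    (∀ x y : ℕ, ¬ ((x, y) ∈ Γ.pos α ∧ (y, x) ∈ Γ.pos α)) ∧
    (∀ x y : ℕ, ¬ ((x, y) ∈ Γ.pos α ∧ (x, y) ∈ Γ.neg α))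

/-- `α ⊩_Γ x < y` : both `x` and `y` occur in `Γ(α)` and no extension `β ⊇ α`
has `Γ(β) ⊨ ¬ (x < y)`. -/
def EnumOp.Forces (Γ : EnumOp) (α : FinLO) (x y : ℕ) : Prop :=
  x ∈ Γ.mem α ∧ y ∈ Γ.mem α ∧ ∀ β : FinLO, α.Ext β → (x, y) ∉ Γ.neg β

/-- Every pair of distinct elements occurring in `Γ(α)` is decided by some
extension of `α`. -/
def EnumOp.Decides (Γ : EnumOp) : Prop :=
  ∀ α : FinLO, ∀ x ∈ Γ.mem α, ∀ y ∈ Γ.mem α, x ≠ y →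
    ∃ β : FinLO, α.Ext β ∧ ((x, y) ∈ Γ.pos β ∨ (x, y) ∈ Γ.neg β)

/-- A (possibly infinite) diagram in the language `{<}` with domain a set of naturals. -/
structure LinDiag where
  dom : Set ℕ
  rel : ℕ → ℕ → Prop

/-- `α` is a finite subdiagram of `L`. -/
def FinLO.SubDiag (α : FinLO) (L : LinDiag) : Prop :=
  ↑α.dom ⊆ L.dom ∧ ∀ x ∈ α.dom, ∀ y ∈ α.dom, (α.rel x y ↔ L.rel x y)

/-- Membership facts enumerated by `Γ` on the infinite diagram `L`. -/
def EnumOp.memD (Γ : EnumOp) (L : LinDiag) : Set ℕ :=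
  {x | ∃ α : FinLO, α.SubDiag L ∧ x ∈ Γ.mem α}

/-- Positive facts `x < y` enumerated by `Γ` on the infinite diagram `L`. -/
def EnumOp.posD (Γ : EnumOp) (L : LinDiag) : Set (ℕ × ℕ) :=
  {p | ∃ α : FinLO, α.SubDiag L ∧ p ∈ Γ.pos α}

/-- Negative facts `¬ x < y` enumerated by `Γ` on the infinite diagram `L`. -/
def EnumOp.negD (Γ : EnumOp) (L : LinDiag) : Set (ℕ × ℕ) :=
  {p | ∃ α : FinLO, α.SubDiag L ∧ p ∈ Γ.neg α}

/-- `L` is (the atomic diagram of) a copy of the linear order `τ`. -/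
def IsCopy (τ : Type) [LinearOrder τ] (L : LinDiag) : Prop :=
  ∃ f : τ → ℕ, Function.Injective f ∧ Set.range f = L.dom ∧
    ∀ i j : τ, (L.rel (f i) (f j) ↔ i < j)

/-- The output of `Γ` on `L` is (the atomic diagram of) a copy of the linear
order `σ`. -/
def EnumOp.OutCopy (Γ : EnumOp) (σ : Type) [LinearOrder σ] (L : LinDiag) : Prop :=
  ∃ g : σ → ℕ, Function.Injective g ∧ Γ.memD L = Set.range g ∧
    (∀ a b : σ, ((g a, g b) ∈ Γ.posD L ↔ a < b)) ∧
    (∀ a b : σ, ((g a, g b) ∈ Γ.negD L ↔ ¬ a < b))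

/-- `Γ` is a computable embedding of the pair `{A, B}` into the pair `{C, D}`:
it maps every copy of `A` to a copy of `C` and every copy of `B` to a copy of `D`. -/
def EnumOp.Embeds (Γ : EnumOp) (A B C D : Type) [LinearOrder A] [LinearOrder B]
    [LinearOrder C] [LinearOrder D] : Prop :=
  (∀ L : LinDiag, IsCopy A L → Γ.OutCopy C L) ∧
  (∀ L : LinDiag, IsCopy B L → Γ.OutCopy D L)

/-- Replace the order of `α` by its reverse. -/
def FinLO.rev (α : FinLO) : FinLO where
  dom := α.dom
  rel x y := α.rel y x
  irrefl := α.irrefl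
  trans x hx y hy z hz h₁ h₂ := α.trans z hz y hy x hx h₂ h₁
  total x hx y hy h := α.total y hy x hx h.symm

/-- Replace the order of `L` by its reverse. -/
def LinDiag.rev (L : LinDiag) : LinDiag where
  dom := L.dom
  rel x y := L.rel y x

theorem IsCopy.rev {τ : Type} [LinearOrder τ] {L : LinDiag} (h : IsCopy τ L) :
    IsCopy τᵒᵈ L.rev := by
  obtain ⟨f, hf, hr, hl⟩ := h
  refine ⟨fun i => f (OrderDual.ofDual i), hf.comp OrderDual.ofDual.injective, ?_, ?_⟩
  · rw [← show Set.range f = L.rev.dom from hr]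
    exact OrderDual.ofDual.surjective.range_comp f
  · intro i j
    exact (hl (OrderDual.ofDual j) (OrderDual.ofDual i)).trans OrderDual.ofDual_lt_ofDual

open Classical in
/-- The number of elements of `α` below `x`. -/
noncomputable def FinLO.rank (α : FinLO) (x : ℕ) : ℕ := (α.dom.filter (α.rel · x)).card

theorem FinLO.rank_lt_card (α : FinLO) {x : ℕ} (hx : x ∈ α.dom) : α.rank x < α.dom.card := by
  classical
  refine Finset.card_lt_card (Finset.filter_ssubset.2 ⟨x, hx, α.irrefl x hx⟩)

theorem FinLO.rank_lt_of_rel (α : FinLO) {x y : ℕ} (hx : x ∈ α.dom) (hy : y ∈ α.dom)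
    (h : α.rel x y) : α.rank x < α.rank y := by
  classical
  refine Finset.card_lt_card ?_
  rw [Finset.ssubset_iff_of_subset]
  · exact ⟨x, by simp [hx, h], by simp [hx, α.irrefl x hx]⟩
  · intro z hz
    rw [Finset.mem_filter] at hz ⊢
    exact ⟨hz.1, α.trans z hz.1 x hx y hy hz.2 h⟩

theorem FinLO.rank_lt_iff (α : FinLO) {x y : ℕ} (hx : x ∈ α.dom) (hy : y ∈ α.dom) :
    α.rank x < α.rank y ↔ α.rel x y := by
  refine ⟨fun h => ?_, α.rank_lt_of_rel hx hy⟩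
  by_contra hn
  rcases eq_or_ne x y with rfl | hne
  · exact lt_irrefl _ h
  · exact lt_asymm h (α.rank_lt_of_rel hy hx ((α.total x hx y hy hne).resolve_left hn))

theorem FinLO.rank_injOn (α : FinLO) : Set.InjOn α.rank α.dom := by
  intro x hx y hy h
  by_contra hne
  rcases α.total x hx y hy hne with h' | h'
  · exact absurd (α.rank_lt_of_rel hx hy h') h.not_lt
  · exact absurd (α.rank_lt_of_rel hy hx h') h.symm.not_lt

/-- The diagram with domain `S` ordered lexicographically by the column `c` and the height `φ`. -/
def keyDiag (S : Set ℕ) (c φ : ℕ → ℕ) : LinDiag where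
  dom := S
  rel x y := c x < c y ∨ c x = c y ∧ φ x < φ y

theorem isCopy_keyDiag {k : ℕ} {S : Set ℕ} {c φ : ℕ → ℕ} (hc : ∀ x ∈ S, c x < k)
    (hφ : Set.InjOn φ S) (hinf : ∀ a < k, {x ∈ S | c x = a}.Infinite) :
    IsCopy (Lex (Fin k × ℕ)) (keyDiag S c φ) := by
  let T : ℕ → ℕ → Prop := fun a m => ∃ x ∈ S, c x = a ∧ φ x = m
  have hT : ∀ a < k, {m | T a m}.Infinite := by
    intro a ha
    have := (hinf a ha).image (hφ.mono (fun x hx => hx.1))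
    refine this.mono ?_
    rintro _ ⟨x, ⟨hx, hxa⟩, rfl⟩
    exact ⟨x, hx, hxa, rfl⟩
  have hex : ∀ p : Lex (Fin k × ℕ), ∃ x ∈ S, c x = (ofLex p).1 ∧
      φ x = Nat.nth (T (ofLex p).1) (ofLex p).2 :=
    fun p => Nat.nth_mem_of_infinite (hT _ (ofLex p).1.2) (ofLex p).2
  choose f hfS hfc hfφ using hex
  have hrel : ∀ i j, (keyDiag S c φ).rel (f i) (f j) ↔ i < j := by
    intro i j
    change c (f i) < c (f j) ∨ c (f i) = c (f j) ∧ φ (f i) < φ (f j) ↔ i < j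
    rw [hfc, hfc, hfφ, hfφ, Prod.Lex.lt_iff, Fin.lt_def, Fin.ext_iff]
    refine or_congr Iff.rfl (and_congr_right fun h => ?_)
    rw [h, Nat.nth_lt_nth (hT _ (ofLex j).1.2)]
  refine ⟨f, ?_, ?_, hrel⟩
  · intro i j hij
    by_contra hne
    rcases lt_or_gt_of_ne hne with h | h
    · have := (hrel i j).2 h
      rw [hij] at this
      exact lt_irrefl j ((hrel j j).1 this)
    · have := (hrel j i).2 h
      rw [hij] at this
      exact lt_irrefl j ((hrel j j).1 this)
  · apply Set.Subset.antisymm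
    · rintro _ ⟨p, rfl⟩
      exact hfS p
    · intro x hx
      have hx' : x ∈ S := hx
      have : φ x ∈ Set.range (Nat.nth (T (c x))) := by
        rw [Nat.range_nth_of_infinite (hT _ (hc x hx'))]
        exact ⟨x, hx', rfl, rfl⟩
      obtain ⟨n, hn⟩ := this
      refine ⟨toLex (⟨c x, hc x hx'⟩, n), hφ (hfS _) hx' ?_⟩
      rw [hfφ]
      exact hn

theorem infinite_setOf_ge_mod {k a : ℕ} (N : ℕ) (ha : a < k) :
    {x | N ≤ x ∧ x % k = a}.Infinite := by
  rw [Set.infinite_iff_exists_gt]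
  intro n
  have hk : 0 < k := by omega
  refine ⟨a + k * (N + n + 1), ⟨?_, ?_⟩, ?_⟩
  · nlinarith
  · rw [Nat.add_mul_mod_self_left, Nat.mod_eq_of_lt ha]
  · nlinarith

/-- `α` followed by a copy of `ω·k` on the naturals `≥ N`. -/
noncomputable def FinLO.pad (α : FinLO) (k N : ℕ) : LinDiag :=
  keyDiag {x | x ∈ α.dom ∨ N ≤ x} (fun x => if x < N then 0 else x % k)
    (fun x => if x < N then α.rank x else x)

theorem FinLO.rank_lt_of_dom_lt (α : FinLO) {N x : ℕ} (hN : ∀ x ∈ α.dom, x < N)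
    (hx : x ∈ α.dom) : α.rank x < N := by
  refine (α.rank_lt_card hx).trans_le ?_
  calc α.dom.card ≤ (Finset.range N).card :=
        Finset.card_le_card (fun y hy => Finset.mem_range.2 (hN y hy))
    _ = N := Finset.card_range N

theorem FinLO.isCopy_pad (α : FinLO) {k N : ℕ} (hk : 0 < k) (hN : ∀ x ∈ α.dom, x < N) :
    IsCopy (Lex (Fin k × ℕ)) (α.pad k N) := by
  apply isCopy_keyDiag
  · intro x _
    split_ifs
    · exact hk
    · exact Nat.mod_lt _ hk
  · intro x hx y hy h
    simp only at h
    have hx' : x < N → x ∈ α.dom := fun h => hx.resolve_right (by omega)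
    have hy' : y < N → y ∈ α.dom := fun h => hy.resolve_right (by omega)
    split_ifs at h with h₁ h₂ h₂
    · exact α.rank_injOn (hx' h₁) (hy' h₂) h
    · have := α.rank_lt_of_dom_lt hN (hx' h₁)
      omega
    · have := α.rank_lt_of_dom_lt hN (hy' h₂)
      omega
    · exact h
  · intro a ha
    refine (infinite_setOf_ge_mod N ha).mono ?_
    rintro x ⟨hx, hxa⟩
    exact ⟨Or.inr hx, by simp [hx.not_gt, hxa]⟩

theorem FinLO.pad_rel_iff_of_lt (α : FinLO) {k N x y : ℕ} (hN : ∀ x ∈ α.dom, x < N)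
    (hx : x ∈ α.dom) (hy : y ∈ α.dom) : (α.pad k N).rel x y ↔ α.rel x y := by
  rw [← α.rank_lt_iff hx hy]
  simp [FinLO.pad, keyDiag, hN x hx, hN y hy]

theorem FinLO.subDiag_pad (α : FinLO) (k : ℕ) {N : ℕ} (hN : ∀ x ∈ α.dom, x < N) :
    α.SubDiag (α.pad k N) :=
  ⟨fun _ hx => Or.inl hx, fun _ hx _ hy => (α.pad_rel_iff_of_lt hN hx hy).symm⟩

/-- `L` is a subdiagram of `M`. -/
def LinDiag.Sub (L M : LinDiag) : Prop :=
  L.dom ⊆ M.dom ∧ ∀ x ∈ L.dom, ∀ y ∈ L.dom, (L.rel x y ↔ M.rel x y)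

theorem FinLO.SubDiag.trans {α : FinLO} {L M : LinDiag} (h : α.SubDiag L) (hLM : L.Sub M) :
    α.SubDiag M :=
  ⟨h.1.trans hLM.1, fun x hx y hy => (h.2 x hx y hy).trans (hLM.2 x (h.1 hx) y (h.1 hy))⟩

theorem EnumOp.posD_mono (Γ : EnumOp) {L M : LinDiag} (h : L.Sub M) : Γ.posD L ⊆ Γ.posD M := by
  rintro p ⟨α, hα, hp⟩
  exact ⟨α, hα.trans h, hp⟩

theorem FinLO.Ext.pad_sub {α β : FinLO} (h : α.Ext β) (k : ℕ) {N : ℕ}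
    (hN : ∀ x ∈ β.dom, x < N) : (α.pad k N).Sub (β.pad k N) := by
  have hN' : ∀ x ∈ α.dom, x < N := fun x hx => hN x (h.1 hx)
  refine ⟨fun x hx => hx.imp (fun h' => h.1 h') id, fun x hx y hy => ?_⟩
  have hx' : x < N → x ∈ α.dom := fun h => hx.resolve_right (by omega)
  have hy' : y < N → y ∈ α.dom := fun h => hy.resolve_right (by omega)
  by_cases hxN : x < N <;> by_cases hyN : y < N
  · rw [α.pad_rel_iff_of_lt hN' (hx' hxN) (hy' hyN),
      β.pad_rel_iff_of_lt hN (h.1 (hx' hxN)) (h.1 (hy' hyN))]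
    exact h.2 x (hx' hxN) y (hy' hyN)
  · have h₁ := α.rank_lt_of_dom_lt hN' (hx' hxN)
    have h₂ := β.rank_lt_of_dom_lt hN (h.1 (hx' hxN))
    have h₃ : α.rank x < y := by omega
    have h₄ : β.rank x < y := by omega
    simp [FinLO.pad, keyDiag, hxN, hyN, h₃, h₄]
  · have h₁ := α.rank_lt_of_dom_lt hN' (hy' hyN)
    have h₂ := β.rank_lt_of_dom_lt hN (h.1 (hy' hyN))
    have h₃ : ¬ x < α.rank y := by omega
    have h₄ : ¬ x < β.rank y := by omega
    simp [FinLO.pad, keyDiag, hxN, hyN, h₃, h₄]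
  · simp [FinLO.pad, keyDiag, hxN, hyN]

/-- `L` is a copy of `ω·k` or of `ω*·k`. -/
def IsEitherCopy (k : ℕ) (L : LinDiag) : Prop :=
  IsCopy (Lex (Fin k × ℕ)) L ∨ IsCopy ((Lex (Fin k × ℕ))ᵒᵈ) L

theorem IsCopy.exists_restrict {τ : Type} [LinearOrder τ] {L : LinDiag} (h : IsCopy τ L)
    {F : Finset ℕ} (hF : ↑F ⊆ L.dom) : ∃ δ : FinLO, δ.dom = F ∧ δ.rel = L.rel := by
  obtain ⟨f, _, hr, hl⟩ := h
  have key : ∀ x ∈ F, ∃ i, f i = x := fun x hx => by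
    have := hF hx
    rwa [← hr] at this
  refine ⟨⟨F, L.rel, ?_, ?_, ?_⟩, rfl, rfl⟩
  · intro x hx
    obtain ⟨i, rfl⟩ := key x hx
    simp [hl]
  · intro x hx y hy z hz
    obtain ⟨i, rfl⟩ := key x hx
    obtain ⟨j, rfl⟩ := key y hy
    obtain ⟨l, rfl⟩ := key z hz
    simp only [hl]
    exact lt_trans
  · intro x hx y hy hne
    obtain ⟨i, rfl⟩ := key x hx
    obtain ⟨j, rfl⟩ := key y hy
    simp only [hl]
    exact lt_or_gt_of_ne (fun h => hne (congrArg f h))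

theorem IsEitherCopy.exists_restrict {k : ℕ} {L : LinDiag} (h : IsEitherCopy k L)
    {F : Finset ℕ} (hF : ↑F ⊆ L.dom) : ∃ δ : FinLO, δ.dom = F ∧ δ.rel = L.rel :=
  h.elim (fun h => h.exists_restrict hF) (fun h => h.exists_restrict hF)

theorem EnumOp.OutCopy.total {Γ : EnumOp} {σ : Type} [LinearOrder σ] {L : LinDiag}
    (h : Γ.OutCopy σ L) {x y : ℕ} (hx : x ∈ Γ.memD L) (hy : y ∈ Γ.memD L) (hne : x ≠ y) :
    (x, y) ∈ Γ.posD L ∨ (y, x) ∈ Γ.posD L := by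
  obtain ⟨g, _, hr, hp, _⟩ := h
  rw [hr] at hx hy
  obtain ⟨a, rfl⟩ := hx
  obtain ⟨b, rfl⟩ := hy
  rw [hp, hp]
  exact lt_or_gt_of_ne (fun h => hne (congrArg g h))

theorem EnumOp.OutCopy.asymm {Γ : EnumOp} {σ : Type} [LinearOrder σ] {L : LinDiag}
    (h : Γ.OutCopy σ L) {x y : ℕ} (hx : x ∈ Γ.memD L) (hy : y ∈ Γ.memD L)
    (hxy : (x, y) ∈ Γ.posD L) (hyx : (y, x) ∈ Γ.posD L) : False := by
  obtain ⟨g, _, hr, hp, _⟩ := h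
  rw [hr] at hx hy
  obtain ⟨a, rfl⟩ := hx
  obtain ⟨b, rfl⟩ := hy
  rw [hp] at hxy hyx
  exact lt_asymm hxy hyx

section Embedding

variable {k : ℕ} {D₀ D₁ : Type} [LinearOrder D₀] [LinearOrder D₁] {Γ : EnumOp}

theorem EnumOp.Embeds.total (hΓ : Γ.Embeds (Lex (Fin k × ℕ)) ((Lex (Fin k × ℕ))ᵒᵈ) D₀ D₁)
    {L : LinDiag} (hL : IsEitherCopy k L) {x y : ℕ} (hx : x ∈ Γ.memD L) (hy : y ∈ Γ.memD L)
    (hne : x ≠ y) : (x, y) ∈ Γ.posD L ∨ (y, x) ∈ Γ.posD L :=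
  hL.elim (fun h => (hΓ.1 L h).total hx hy hne) (fun h => (hΓ.2 L h).total hx hy hne)

/-- Two extensions of a finite order cannot disagree on elements it has already enumerated. -/
theorem EnumOp.Embeds.not_pos_of_ext (hk : 0 < k)
    (hΓ : Γ.Embeds (Lex (Fin k × ℕ)) ((Lex (Fin k × ℕ))ᵒᵈ) D₀ D₁)
    {α β γ : FinLO} (hβ : α.Ext β) (hγ : α.Ext γ) {x y : ℕ} (hx : x ∈ Γ.mem α)
    (hy : y ∈ Γ.mem α) (hne : x ≠ y) (hxy : (x, y) ∈ Γ.pos β) : (y, x) ∉ Γ.pos γ := by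
  intro hyx
  obtain ⟨N, hNβ, hNγ⟩ : ∃ N, (∀ x ∈ β.dom, x < N) ∧ ∀ x ∈ γ.dom, x < N := by
    refine ⟨(β.dom ∪ γ.dom).sup id + 1, fun x hx => ?_, fun x hx => ?_⟩ <;>
    exact Nat.lt_succ_of_le (Finset.le_sup (f := id) (by simp [hx]))
  have hNα : ∀ x ∈ α.dom, x < N := fun x hx => hNβ x (hβ.1 hx)
  have hα := α.isCopy_pad hk hNα
  have mem : ∀ z ∈ Γ.mem α, z ∈ Γ.memD (α.pad k N) := fun z hz => ⟨α, α.subDiag_pad k hNα, hz⟩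
  rcases (hΓ.1 _ hα).total (mem x hx) (mem y hy) hne with h | h
  · exact (hΓ.1 _ (γ.isCopy_pad hk hNγ)).asymm ⟨γ, γ.subDiag_pad k hNγ, Γ.mono_mem hγ hx⟩
      ⟨γ, γ.subDiag_pad k hNγ, Γ.mono_mem hγ hy⟩ (Γ.posD_mono (hγ.pad_sub k hNγ) h)
      ⟨γ, γ.subDiag_pad k hNγ, hyx⟩
  · exact (hΓ.1 _ (β.isCopy_pad hk hNβ)).asymm ⟨β, β.subDiag_pad k hNβ, Γ.mono_mem hβ hx⟩
      ⟨β, β.subDiag_pad k hNβ, Γ.mono_mem hβ hy⟩ ⟨β, β.subDiag_pad k hNβ, hxy⟩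
      (Γ.posD_mono (hβ.pad_sub k hNβ) h)

/-- In `L`, all of `α` lies below all of `β`. -/
def Below (L : LinDiag) (α β : FinLO) : Prop :=
  α.SubDiag L ∧ β.SubDiag L ∧ ∀ u ∈ α.dom, ∀ v ∈ β.dom, L.rel u v ∧ ¬ L.rel v u

/-- If `α` lies below `β` in both `L` and `M`, then `L` and `M` agree on the order between
elements enumerated by `α` and by `β`. -/
theorem EnumOp.Embeds.posD_of_below (hk : 0 < k)
    (hΓ : Γ.Embeds (Lex (Fin k × ℕ)) ((Lex (Fin k × ℕ))ᵒᵈ) D₀ D₁)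
    {L M : LinDiag} (hL : IsEitherCopy k L) (hM : IsEitherCopy k M) {α β : FinLO}
    (hLb : Below L α β) (hMb : Below M α β) {x y : ℕ} (hx : x ∈ Γ.mem α) (hy : y ∈ Γ.mem β)
    (hne : x ≠ y) (hxy : (x, y) ∈ Γ.posD L) : (x, y) ∈ Γ.posD M := by
  classical
  obtain ⟨hLα, hLβ, hLr⟩ := hLb
  obtain ⟨hMα, hMβ, hMr⟩ := hMb
  refine (hΓ.total hM ⟨α, hMα, hx⟩ ⟨β, hMβ, hy⟩ hne).resolve_right fun hyx => ?_
  obtain ⟨γ, hγ, hxy⟩ := hxy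
  obtain ⟨γ', hγ', hyx⟩ := hyx
  obtain ⟨δ, hδ, hδr⟩ := hL.exists_restrict (F := α.dom ∪ β.dom)
    (by rw [Finset.coe_union]; exact Set.union_subset hLα.1 hLβ.1)
  obtain ⟨ε, hε, hεr⟩ := hL.exists_restrict (F := α.dom ∪ β.dom ∪ γ.dom)
    (by simp only [Finset.coe_union]
        exact Set.union_subset (Set.union_subset hLα.1 hLβ.1) hγ.1)
  obtain ⟨ζ, hζ, hζr⟩ := hM.exists_restrict (F := α.dom ∪ β.dom ∪ γ'.dom)
    (by simp only [Finset.coe_union]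
        exact Set.union_subset (Set.union_subset hMα.1 hMβ.1) hγ'.1)
  have hαδ : α.Ext δ := ⟨by rw [hδ]; exact Finset.subset_union_left, by rw [hδr]; exact hLα.2⟩
  have hβδ : β.Ext δ := ⟨by rw [hδ]; exact Finset.subset_union_right, by rw [hδr]; exact hLβ.2⟩
  have hδε : δ.Ext ε := ⟨by rw [hδ, hε]; exact Finset.subset_union_left, by simp [hδr, hεr]⟩
  have hγε : γ.Ext ε := ⟨by rw [hε]; exact Finset.subset_union_right, by rw [hεr]; exact hγ.2⟩
  have hγζ : γ'.Ext ζ := ⟨by rw [hζ]; exact Finset.subset_union_right, by rw [hζr]; exact hγ'.2⟩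
  have hδζ : δ.Ext ζ := by
    refine ⟨by rw [hδ, hζ]; exact Finset.subset_union_left, ?_⟩
    rw [hδ, hδr, hζr]
    intro u hu v hv
    rcases Finset.mem_union.1 hu with hu | hu <;> rcases Finset.mem_union.1 hv with hv | hv
    · exact (hLα.2 u hu v hv).symm.trans (hMα.2 u hu v hv)
    · exact iff_of_true (hLr u hu v hv).1 (hMr u hu v hv).1
    · exact iff_of_false (hLr v hv u hu).2 (hMr v hv u hu).2
    · exact (hLβ.2 u hu v hv).symm.trans (hMβ.2 u hu v hv)
  exact hΓ.not_pos_of_ext hk hδε hδζ (Γ.mono_mem hαδ hx) (Γ.mono_mem hβδ hy) hne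
    (Γ.mono_pos hγε hxy) (Γ.mono_pos hγζ hyx)

end Embedding

/-- `α` is a sequence of nonempty finite orders living on successive intervals of naturals. -/
structure IsBlocks (α : ℕ → FinLO) (N : ℕ → ℕ) : Prop where
  strictMono : StrictMono N
  le : ∀ i, ∀ x ∈ (α i).dom, N i ≤ x
  lt : ∀ i, ∀ x ∈ (α i).dom, x < N (i + 1)
  nonempty : ∀ i, (α i).dom.Nonempty

theorem IsBlocks.comp {α : ℕ → FinLO} {N : ℕ → ℕ} (h : IsBlocks α N) {f : ℕ → ℕ}
    (hf : StrictMono f) : IsBlocks (α ∘ f) (N ∘ f) where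
  strictMono := h.strictMono.comp hf
  le i := h.le (f i)
  lt i x hx := (h.lt (f i) x hx).trans_le (h.strictMono.monotone (hf i.lt_succ_self))
  nonempty i := h.nonempty (f i)

theorem IsBlocks.rev {α : ℕ → FinLO} {N : ℕ → ℕ} (h : IsBlocks α N) :
    IsBlocks (fun i => (α i).rev) N :=
  ⟨h.strictMono, h.le, h.lt, h.nonempty⟩

/-- The order in which the blocks are arranged: by residue modulo `k`, then by index. -/
def ModLex (k i j : ℕ) : Prop := i % k < j % k ∨ i % k = j % k ∧ i < j

theorem IsBlocks.exists_isCopy {k : ℕ} (hk : 0 < k) {α : ℕ → FinLO} {N : ℕ → ℕ}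
    (h : IsBlocks α N) : ∃ L, IsCopy (Lex (Fin k × ℕ)) L ∧ (∀ i, (α i).SubDiag L) ∧
      ∀ i j, i ≠ j → ∀ u ∈ (α i).dom, ∀ v ∈ (α j).dom, (L.rel u v ↔ ModLex k i j) := by
  have uniq : ∀ {i j x}, x ∈ (α i).dom → x ∈ (α j).dom → i = j := by
    intro i j x hi hj
    by_contra hne
    rcases lt_or_gt_of_ne hne with hlt | hlt
    · have : N (i + 1) ≤ N j := h.strictMono.monotone hlt
      have := h.lt i x hi
      have := h.le j x hj
      omega
    · have : N (j + 1) ≤ N i := h.strictMono.monotone hlt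
      have := h.lt j x hj
      have := h.le i x hi
      omega
  have hex : ∀ x, ∃ i, (∃ j, x ∈ (α j).dom) → x ∈ (α i).dom := by
    intro x
    by_cases hx : ∃ j, x ∈ (α j).dom
    · exact ⟨hx.choose, fun _ => hx.choose_spec⟩
    · exact ⟨0, fun h => absurd h hx⟩
  choose idx hidx using hex
  have idx_eq : ∀ {i x}, x ∈ (α i).dom → idx x = i :=
    fun {i x} hx => uniq (hidx x ⟨i, hx⟩) hx
  let φ : ℕ → ℕ := fun x => N (idx x) + (α (idx x)).rank x
  have hφ : ∀ {i x}, x ∈ (α i).dom → φ x = N i + (α i).rank x := by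
    intro i x hx
    simp only [φ, idx_eq hx]
  have hrank : ∀ {i x}, x ∈ (α i).dom → N i + (α i).rank x < N (i + 1) := by
    intro i x hx
    have h₁ := (α i).rank_lt_card hx
    have h₂ : (α i).dom.card ≤ (Finset.Ico (N i) (N (i + 1))).card :=
      Finset.card_le_card fun y hy => Finset.mem_Ico.2 ⟨h.le i y hy, h.lt i y hy⟩
    rw [Nat.card_Ico] at h₂
    omega
  have hlt : ∀ {i j u v}, i < j → u ∈ (α i).dom → v ∈ (α j).dom → φ u < φ v := by
    intro i j u v hij hu hv
    rw [hφ hu, hφ hv]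
    have : N (i + 1) ≤ N j := h.strictMono.monotone hij
    have := hrank hu
    omega
  refine ⟨keyDiag {x | ∃ i, x ∈ (α i).dom} (fun x => idx x % k) φ,
    isCopy_keyDiag (fun x _ => Nat.mod_lt _ hk) ?_ ?_, ?_, ?_⟩
  · rintro x ⟨i, hi⟩ y ⟨j, hj⟩ hxy
    rcases lt_trichotomy i j with hij | rfl | hij
    · exact absurd hxy (hlt hij hi hj).ne
    · rw [hφ hi, hφ hj] at hxy
      exact (α i).rank_injOn hi hj (by omega)
    · exact absurd hxy (hlt hij hj hi).ne'
  · intro a ha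
    choose w hw using h.nonempty
    have hinj : Function.Injective w := fun i j hij => uniq (hw i) (hij ▸ hw j)
    refine ((infinite_setOf_ge_mod 0 ha).image hinj.injOn).mono ?_
    rintro _ ⟨i, ⟨_, hi⟩, rfl⟩
    exact ⟨⟨i, hw i⟩, by simp only [idx_eq (hw i), hi]⟩
  · refine fun i => ⟨fun x hx => ⟨i, hx⟩, fun x hx y hy => ?_⟩
    simp only [keyDiag, idx_eq hx, idx_eq hy, hφ hx, hφ hy, lt_irrefl, false_or, true_and,
      Nat.add_lt_add_iff_left]
    exact ((α i).rank_lt_iff hx hy).symm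
  · intro i j hne u hu v hv
    simp only [keyDiag, ModLex, idx_eq hu, idx_eq hv]
    refine or_congr Iff.rfl (and_congr_right fun _ => ?_)
    rcases lt_or_gt_of_ne hne with hij | hij
    · exact iff_of_true (hlt hij hu hv) hij
    · exact iff_of_false (hlt hij hv hu).not_gt hij.not_gt

theorem ModLex.not_symm {k i j : ℕ} (h : ModLex k i j) : i ≠ j ∧ ¬ ModLex k j i := by
  unfold ModLex at *
  constructor
  · rintro rfl
    omega
  · omega

theorem IsBlocks.exists_isCopy_below {k : ℕ} (hk : 0 < k) {α : ℕ → FinLO} {N : ℕ → ℕ}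
    (h : IsBlocks α N) : ∃ L, IsCopy (Lex (Fin k × ℕ)) L ∧ (∀ i, (α i).SubDiag L) ∧
      ∀ i j, ModLex k i j → Below L (α i) (α j) := by
  obtain ⟨L, hL, hs, hr⟩ := h.exists_isCopy hk
  refine ⟨L, hL, hs, fun i j hij => ⟨hs i, hs j, fun u hu v hv => ?_⟩⟩
  obtain ⟨hne, hn⟩ := hij.not_symm
  rw [hr i j hne u hu v hv, hr j i hne.symm v hv u hu]
  exact ⟨hij, hn⟩

theorem IsBlocks.exists_isCopy_dual_below {k : ℕ} (hk : 0 < k) {α : ℕ → FinLO} {N : ℕ → ℕ}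
    (h : IsBlocks α N) : ∃ L, IsCopy ((Lex (Fin k × ℕ))ᵒᵈ) L ∧ (∀ i, (α i).SubDiag L) ∧
      ∀ i j, ModLex k i j → Below L (α j) (α i) := by
  obtain ⟨L, hL, hs, hr⟩ := h.rev.exists_isCopy_below hk
  have hs' : ∀ i, (α i).SubDiag L.rev :=
    fun i => ⟨(hs i).1, fun x hx y hy => (hs i).2 y hy x hx⟩
  exact ⟨L.rev, hL.rev, hs', fun i j hij =>
    ⟨hs' j, hs' i, fun u hu v hv => (hr i j hij).2.2 v hv u hu⟩⟩

theorem modLex_mul {k i j : ℕ} (h : i < j) (hk : 0 < k) : ModLex k (k * i) (k * j) :=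
  Or.inr ⟨by simp, Nat.mul_lt_mul_of_pos_left h hk⟩

theorem modLex_of_lt {k : ℕ} {p q : Lex (Fin k × ℕ)} (h : p < q) :
    ModLex k ((ofLex p).1 + k * (ofLex p).2) ((ofLex q).1 + k * (ofLex q).2) := by
  have hk : 0 < k := (Nat.zero_le _).trans_lt (ofLex p).1.2
  unfold ModLex
  rw [Nat.add_mul_mod_self_left, Nat.add_mul_mod_self_left, Nat.mod_eq_of_lt (ofLex p).1.2,
    Nat.mod_eq_of_lt (ofLex q).1.2]
  rcases Prod.Lex.lt_iff.1 h with h | ⟨h₁, h₂⟩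
  · exact Or.inl h
  · refine Or.inr ⟨congrArg Fin.val h₁, ?_⟩
    rw [h₁]
    exact Nat.add_lt_add_left (Nat.mul_lt_mul_of_pos_left h₂ hk) _

section Blocks

variable {k : ℕ} {D₀ D₁ : Type} [LinearOrder D₀] [LinearOrder D₁] {Γ : EnumOp}

theorem EnumOp.Embeds.exists_mem_ge [Infinite D₁] (hk : 0 < k)
    (hΓ : Γ.Embeds (Lex (Fin k × ℕ)) ((Lex (Fin k × ℕ))ᵒᵈ) D₀ D₁) (N : ℕ) :
    ∃ (α : FinLO) (x : ℕ), α.dom.Nonempty ∧ (∀ u ∈ α.dom, N ≤ u) ∧ N ≤ x ∧ x ∈ Γ.mem α := by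
  have hL : IsCopy ((Lex (Fin k × ℕ))ᵒᵈ) (keyDiag {x | N ≤ x} (· % k) id).rev :=
    (isCopy_keyDiag (fun x _ => Nat.mod_lt x hk) Function.injective_id.injOn
      (fun a ha => infinite_setOf_ge_mod N ha)).rev
  obtain ⟨g, hg, hr, _⟩ := hΓ.2 _ hL
  have hinf := Set.infinite_range_of_injective hg
  rw [← hr] at hinf
  obtain ⟨x, ⟨α, hα, hx⟩, hxN⟩ := hinf.exists_gt N
  have hsub : ((insert N α.dom : Finset ℕ) : Set ℕ) ⊆ {x | N ≤ x} := by
    rw [Finset.coe_insert]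
    exact Set.insert_subset (le_refl N) hα.1
  obtain ⟨δ, hδ, hδr⟩ := hL.exists_restrict hsub
  refine ⟨δ, x, ⟨N, by simp [hδ]⟩, ?_, hxN.le, Γ.mono_mem ⟨?_, ?_⟩ hx⟩
  · rw [hδ]
    exact hsub
  · rw [hδ]
    exact Finset.subset_insert _ _
  · rw [hδr]
    exact hα.2

theorem EnumOp.Embeds.exists_isBlocks [Infinite D₁] (hk : 0 < k)
    (hΓ : Γ.Embeds (Lex (Fin k × ℕ)) ((Lex (Fin k × ℕ))ᵒᵈ) D₀ D₁) :
    ∃ (α : ℕ → FinLO) (N x : ℕ → ℕ), IsBlocks α N ∧ (∀ i, x i ∈ Γ.mem (α i)) ∧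
      Function.Injective x := by
  choose α x hne hle hx hmem using hΓ.exists_mem_ge hk
  let next : ℕ → ℕ := fun n => max (x n) ((α n).dom.sup id) + 1
  let N : ℕ → ℕ := fun i => next^[i] 0
  have hN : ∀ i, N (i + 1) = next (N i) := fun i => Function.iterate_succ_apply' next i 0
  have hxN : ∀ i, x (N i) < N (i + 1) := fun i => by
    rw [hN]
    exact Nat.lt_succ_of_le (le_max_left _ _)
  refine ⟨fun i => α (N i), N, fun i => x (N i), ⟨?_, fun i => hle _, ?_, fun i => hne _⟩,
    fun i => hmem _, ?_⟩
  · exact strictMono_nat_of_lt_succ fun i => (hx (N i)).trans_lt (hxN i)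
  · intro i u hu
    rw [hN]
    exact Nat.lt_succ_of_le ((Finset.le_sup (f := id) hu).trans (le_max_right _ _))
  · exact (strictMono_nat_of_lt_succ fun i => (hxN i).trans_le (hx _)).injective

/-- `α` followed by `β` puts `x` below `y`. -/
def SumPos (Γ : EnumOp) (k : ℕ) (α β : FinLO) (x y : ℕ) : Prop :=
  ∃ L, IsEitherCopy k L ∧ Below L α β ∧ (x, y) ∈ Γ.posD L

theorem exists_strictMono_sumPos
    (hk : 0 < k) (hΓ : Γ.Embeds (Lex (Fin k × ℕ)) ((Lex (Fin k × ℕ))ᵒᵈ) D₀ D₁)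
    (h0 : ¬ ∃ f : ℕ → D₀, StrictAnti f) {α : ℕ → FinLO} {N x : ℕ → ℕ} (h : IsBlocks α N)
    (hx : ∀ i, x i ∈ Γ.mem (α i)) (hinj : Function.Injective x) :
    ∃ f : ℕ → ℕ, StrictMono f ∧
      ∀ i j, i < j → SumPos Γ k (α (f i)) (α (f j)) (x (f i)) (x (f j)) := by
  obtain ⟨L, hL, hs, hb⟩ := h.exists_isCopy_below hk
  obtain ⟨g, _, hr, hp, _⟩ := hΓ.1 L hL
  have hd : ∀ i, ∃ d, g d = x (k * i) := fun i => by
    have : x (k * i) ∈ Γ.memD L := ⟨_, hs _, hx _⟩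
    rwa [hr] at this
  choose d hd using hd
  have hdinj : Function.Injective d := fun i j hij =>
    Nat.eq_of_mul_eq_mul_left hk (hinj (by rw [← hd, ← hd, hij]))
  obtain ⟨f, hf | hf⟩ := exists_increasing_or_nonincreasing_subseq (· < ·) d
  · refine ⟨fun i => k * f i, fun i j hij => Nat.mul_lt_mul_of_pos_left (f.strictMono hij) hk,
      fun i j hij => ⟨L, Or.inl hL, hb _ _ (modLex_mul (f.strictMono hij) hk), ?_⟩⟩
    rw [← hd, ← hd, hp]
    exact hf i j hij
  · refine absurd ⟨fun i => d (f i), fun i j hij => ?_⟩ h0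
    exact lt_of_le_of_ne (not_lt.1 (hf i j hij))
      fun he => (f.strictMono hij).ne' (hdinj he)

theorem exists_strictMono_sumPos_dual
    (hk : 0 < k) (hΓ : Γ.Embeds (Lex (Fin k × ℕ)) ((Lex (Fin k × ℕ))ᵒᵈ) D₀ D₁)
    (h1 : ¬ ∃ f : ℕ → D₁, StrictMono f) {α : ℕ → FinLO} {N x : ℕ → ℕ} (h : IsBlocks α N)
    (hx : ∀ i, x i ∈ Γ.mem (α i)) (hinj : Function.Injective x) :
    ∃ f : ℕ → ℕ, StrictMono f ∧
      ∀ i j, i < j → SumPos Γ k (α (f j)) (α (f i)) (x (f j)) (x (f i)) := by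
  obtain ⟨L, hL, hs, hb⟩ := h.exists_isCopy_dual_below hk
  obtain ⟨g, _, hr, hp, _⟩ := hΓ.2 L hL
  have hd : ∀ i, ∃ d, g d = x (k * i) := fun i => by
    have : x (k * i) ∈ Γ.memD L := ⟨_, hs _, hx _⟩
    rwa [hr] at this
  choose d hd using hd
  have hdinj : Function.Injective d := fun i j hij =>
    Nat.eq_of_mul_eq_mul_left hk (hinj (by rw [← hd, ← hd, hij]))
  obtain ⟨f, hf | hf⟩ := exists_increasing_or_nonincreasing_subseq (· > ·) d
  · refine ⟨fun i => k * f i, fun i j hij => Nat.mul_lt_mul_of_pos_left (f.strictMono hij) hk,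
      fun i j hij => ⟨L, Or.inr hL, hb _ _ (modLex_mul (f.strictMono hij) hk), ?_⟩⟩
    rw [← hd, ← hd, hp]
    exact hf i j hij
  · refine absurd ⟨fun i => d (f i), fun i j hij => ?_⟩ h1
    exact lt_of_le_of_ne (not_lt.1 (hf i j hij))
      fun he => (f.strictMono hij).ne (hdinj he)

/-- There are blocks whose enumerated elements are ordered like the blocks, for every
arrangement of the blocks. -/
theorem EnumOp.Embeds.exists_isBlocks_sumPos [Infinite D₁] (hk : 0 < k)
    (hΓ : Γ.Embeds (Lex (Fin k × ℕ)) ((Lex (Fin k × ℕ))ᵒᵈ) D₀ D₁)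
    (h0 : ¬ ∃ f : ℕ → D₀, StrictAnti f) (h1 : ¬ ∃ f : ℕ → D₁, StrictMono f) :
    ∃ (α : ℕ → FinLO) (N x : ℕ → ℕ), IsBlocks α N ∧ (∀ i, x i ∈ Γ.mem (α i)) ∧
      Function.Injective x ∧ ∀ i j, i ≠ j → SumPos Γ k (α i) (α j) (x i) (x j) := by
  obtain ⟨α, N, x, hα, hx, hinj⟩ := hΓ.exists_isBlocks hk
  obtain ⟨f, hf, hfs⟩ := exists_strictMono_sumPos hk hΓ h0 hα hx hinj
  obtain ⟨f', hf', hfs'⟩ := exists_strictMono_sumPos_dual (x := x ∘ f) hk hΓ h1 (hα.comp hf)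
    (fun i => hx (f i)) (hinj.comp hf.injective)
  refine ⟨α ∘ f ∘ f', N ∘ f ∘ f', x ∘ f ∘ f', hα.comp (hf.comp hf'), fun i => hx _,
    hinj.comp (hf.comp hf').injective, fun i j hij => ?_⟩
  rcases lt_or_gt_of_ne hij with hij | hij
  · exact hfs _ _ (hf' hij)
  · exact hfs' _ _ hij

end Blocks

/-- if `k ≥ 2` and `Γ : {ω·k, ω*·k} ≤_c {D₀, D₁}` where `D₀` has no
infinite descending chains and `D₁` is infinite with no infinite ascending
chains, then `D₀` contains a suborder of type `ω·k` and `D₁` one of type `ω*·k`. -/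
theorem target_contains_omega_k (k : ℕ) (hk : 2 ≤ k) (D₀ D₁ : Type)
    [LinearOrder D₀] [LinearOrder D₁] [Infinite D₁]
    (Γ : EnumOp) (hΓ : Γ.Embeds (Lex (Fin k × ℕ)) ((Lex (Fin k × ℕ))ᵒᵈ) D₀ D₁)
    (h0 : ¬ ∃ f : ℕ → D₀, StrictAnti f) (h1 : ¬ ∃ f : ℕ → D₁, StrictMono f) :
    Nonempty (Lex (Fin k × ℕ) ↪o D₀) ∧ Nonempty ((Lex (Fin k × ℕ))ᵒᵈ ↪o D₁) := by
  have hk0 : 0 < k := by omega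
  obtain ⟨α, N, x, hα, hx, hinj, hsum⟩ := hΓ.exists_isBlocks_sumPos hk0 h0 h1
  have pos : ∀ {M i j}, IsEitherCopy k M → i ≠ j → Below M (α i) (α j) →
      (x i, x j) ∈ Γ.posD M := by
    intro M i j hM hij hMb
    obtain ⟨L, hL, hLb, hxy⟩ := hsum i j hij
    exact hΓ.posD_of_below hk0 hL hM hLb hMb (hx i) (hx j) (hinj.ne hij) hxy
  let e : Lex (Fin k × ℕ) → ℕ := fun p => (ofLex p).1 + k * (ofLex p).2
  constructor
  · obtain ⟨L, hL, hs, hb⟩ := hα.exists_isCopy_below hk0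
    obtain ⟨g, _, hr, hp, _⟩ := hΓ.1 L hL
    have hd : ∀ p, ∃ d, g d = x (e p) := fun p => by
      have : x (e p) ∈ Γ.memD L := ⟨_, hs _, hx _⟩
      rwa [hr] at this
    choose d hd using hd
    refine ⟨OrderEmbedding.ofStrictMono d fun p q hpq => ?_⟩
    have hm := modLex_of_lt hpq
    rw [← hp, hd, hd]
    exact pos (Or.inl hL) hm.not_symm.1 (hb _ _ hm)
  · obtain ⟨L, hL, hs, hb⟩ := hα.exists_isCopy_dual_below hk0
    obtain ⟨g, _, hr, hp, _⟩ := hΓ.2 L hL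
    have hd : ∀ p : (Lex (Fin k × ℕ))ᵒᵈ, ∃ d, g d = x (e (OrderDual.ofDual p)) := fun p => by
      have : x (e (OrderDual.ofDual p)) ∈ Γ.memD L := ⟨_, hs _, hx _⟩
      rwa [hr] at this
    choose d hd using hd
    refine ⟨OrderEmbedding.ofStrictMono d fun p q hpq => ?_⟩
    have hm := modLex_of_lt (OrderDual.ofDual_lt_ofDual.2 hpq)
    rw [← hp, hd, hd]
    exact pos (Or.inr hL) hm.not_symm.1.symm (hb _ _ hm)
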